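/- arXiv:1212.3410 — 4 statements merged into one kernel-verified Lean document; each statement's English description precedes it below -/
import Mathlib

section
/- Let a < b, let N ≥ 1, let n be a positive integer and n-1 < α < n with N ≥ n, and let x_0, …, x_N be distinct points in [a,b] satisfying x_i - a = b - x_{N-i} for all i. Let c_{i,k} and d_{i,k} be the coefficients of the Lagrange basis polynomials in powers of (x-a) and (x-b), respectively, and define the differentiation matrices _LD_{ji}^{(α)} = Σ_{k=0}^N c_{i,k} (Γ(N-k+1)/Γ(N-k+1-α)) (x_j-a)^{N-k-α} and _RD_{ji}^{(α)} = Σ_{k=0}^N d_{i,k} (-1)^{N-k} (Γ(N-k+1)/Γ(N-k+1-α)) (b-x_j)^{N-k-α}, where a power 0^s with s < 0 is interpreted as 0. Then _LD_{ji}^{(α)} = _RD_{N-j, N-i}^{(α)} for all i, j = 0, …, N; that is, the right Riemann–Liouville differentiation matrix is the 180-degree rotation of the left one. -/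
open Finset

/-- A real polynomial function of degree at most `N` determines its coefficients,
listed by descending powers. -/
lemma coeff_eq_of_forall_sum_pow_eq {N : ℕ} {f g : ℕ → ℝ}
    (h : ∀ t : ℝ, ∑ k ∈ range (N + 1), f k * t ^ (N - k) =
      ∑ k ∈ range (N + 1), g k * t ^ (N - k)) {k : ℕ} (hk : k ≤ N) : f k = g k := by
  have hp : (∑ k ∈ range (N + 1), Polynomial.monomial (N - k) (f k)) =
      ∑ k ∈ range (N + 1), Polynomial.monomial (N - k) (g k) :=
    Polynomial.funext fun t => by
      simpa [Polynomial.eval_finsetSum, Polynomial.eval_monomial] using h t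
  have coeff_sum (u : ℕ → ℝ) :
      (∑ m ∈ range (N + 1), Polynomial.monomial (N - m) (u m)).coeff (N - k) = u k := by
    rw [Polynomial.finsetSum_coeff, sum_eq_single_of_mem k (by simpa [Nat.lt_succ_iff] using hk)]
    · simp
    · intro m hm hmk
      rw [mem_range] at hm
      rw [Polynomial.coeff_monomial, if_neg (by omega)]
  rw [← coeff_sum f, hp, coeff_sum g]

/-- Reflecting a symmetric node set exchanges the Lagrange basis polynomials `i` and `i.rev`. -/
lemma lagrange_basis_add_eq_rev_sub {a b : ℝ} {N : ℕ} {x : Fin (N + 1) → ℝ}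
    (hsymm : ∀ i : Fin (N + 1), x i - a = b - x i.rev) (i : Fin (N + 1)) (t : ℝ) :
    ∏ j ∈ univ.erase i, (a + t - x j) / (x i - x j) =
      ∏ j ∈ univ.erase i.rev, (b - t - x j) / (x i.rev - x j) := by
  refine prod_bij' (fun j _ => j.rev) (fun j _ => j.rev) ?_ ?_ ?_ ?_ ?_
  · simp
  · simp [Fin.rev_eq_iff]
  · simp
  · simp
  · intro j _
    rw [← neg_div_neg_eq]
    congr 1 <;> linarith [hsymm i, hsymm j]

/-- **Rotation symmetry of the Riemann–Liouville spectral differentiation matrices**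
(Proposition 1 (2)).  If the distinct nodes `x_0,…,x_N ⊆ [a,b]` satisfy
`x_i - a = b - x_{N-i}`, then the left differentiation matrix
`_LD_{ji}^{(α)} = Σ_k c_{i,k} (Γ(N-k+1)/Γ(N-k+1-α)) (x_j-a)^(N-k-α)` and the
right one `_RD_{ji}^{(α)} = Σ_k d_{i,k} (-1)^(N-k) (Γ(N-k+1)/Γ(N-k+1-α)) (b-x_j)^(N-k-α)`
satisfy `_LD_{ji}^{(α)} = _RD_{N-j,N-i}^{(α)}`.  (A real power `0^s` with `s < 0`
is `0` for `Real.rpow`, matching the stated convention.) -/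
theorem RL_differentiation_matrix_rotation (a b : ℝ) (hab : a < b)
    (N : ℕ) (hN : 1 ≤ N) (n : ℕ) (hn : 0 < n)
    (α : ℝ) (hα₁ : (n : ℝ) - 1 < α) (hα₂ : α < n) (hnN : n ≤ N)
    (x : Fin (N + 1) → ℝ) (hinj : Function.Injective x)
    (hmem : ∀ i, x i ∈ Set.Icc a b)
    (hsymm : ∀ i : Fin (N + 1), x i - a = b - x i.rev)
    (c d : Fin (N + 1) → ℕ → ℝ)
    (hc : ∀ i, ∀ y : ℝ,
      (∏ j ∈ univ.erase i, (y - x j) / (x i - x j)) =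
        ∑ k ∈ Finset.range (N + 1), c i k * (y - a) ^ (N - k))
    (hd : ∀ i, ∀ y : ℝ,
      (∏ j ∈ univ.erase i, (y - x j) / (x i - x j)) =
        ∑ k ∈ Finset.range (N + 1), d i k * (y - b) ^ (N - k))
    (LD RD : Fin (N + 1) → Fin (N + 1) → ℝ)
    (hLD : ∀ j i, LD j i = ∑ k ∈ Finset.range (N + 1),
      c i k * (Real.Gamma ((N : ℝ) - k + 1) / Real.Gamma ((N : ℝ) - k + 1 - α)) *
        (x j - a) ^ ((N : ℝ) - k - α))
    (hRD : ∀ j i, RD j i = ∑ k ∈ Finset.range (N + 1),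
      d i k * (-1 : ℝ) ^ (N - k) *
        (Real.Gamma ((N : ℝ) - k + 1) / Real.Gamma ((N : ℝ) - k + 1 - α)) *
        (b - x j) ^ ((N : ℝ) - k - α)) :
    ∀ j i : Fin (N + 1), LD j i = RD j.rev i.rev := by
  intro j i
  have hcd (t : ℝ) : ∑ k ∈ range (N + 1), c i k * t ^ (N - k) =
      ∑ k ∈ range (N + 1), d i.rev k * (-1 : ℝ) ^ (N - k) * t ^ (N - k) := by
    have hl := hc i (a + t)
    have hr := hd i.rev (b - t)
    rw [lagrange_basis_add_eq_rev_sub hsymm, hr] at hl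
    simp only [add_sub_cancel_left, sub_sub_cancel_left] at hl
    rw [← hl]
    refine sum_congr rfl fun k _ => ?_
    rw [neg_pow t, mul_assoc]
  rw [hLD, hRD, ← hsymm j]
  refine sum_congr rfl fun k hk => ?_
  rw [coeff_eq_of_forall_sum_pow_eq hcd (Nat.lt_succ_iff.mp (mem_range.mp hk))]
end

section
/- Let a < b, let N ≥ 1, let n be a positive integer and n-1 < α < n with N ≥ n, and let x_0, …, x_N be distinct points in [a,b] satisfying x_i - a = b - x_{N-i} for all i. Let c_{i,k} and d_{i,k} be the coefficients of the Lagrange basis polynomials in powers of (x-a) and (x-b), respectively, and define the Caputo differentiation matrices _L^CD_{ji}^{(α)} = Σ_{k=0}^{N-n} c_{i,k} (Γ(N-k+1)/Γ(N-k+1-α)) (x_j-a)^{N-k-α} and _R^CD_{ji}^{(α)} = Σ_{k=0}^{N-n} d_{i,k} (-1)^{N-k} (Γ(N-k+1)/Γ(N-k+1-α)) (b-x_j)^{N-k-α}. Then _L^CD_{ji}^{(α)} = _R^CD_{N-j, N-i}^{(α)} for all i, j = 0, …, N. -/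
open Finset

/-- Coefficients with respect to the descending monomials `t ^ N, …, t, 1` are determined by the
polynomial function they define. -/
lemma coeff_eq_of_forall_sum_mul_pow_sub_eq {R : Type*} [CommRing R] [IsDomain R] [Infinite R]
    {N : ℕ} {u v : ℕ → R}
    (h : ∀ t : R, ∑ k ∈ range (N + 1), u k * t ^ (N - k) =
      ∑ k ∈ range (N + 1), v k * t ^ (N - k))
    {k : ℕ} (hk : k ≤ N) : u k = v k := by
  have hpoly : ∑ m ∈ range (N + 1), Polynomial.monomial (N - m) (u m) =
      ∑ m ∈ range (N + 1), Polynomial.monomial (N - m) (v m) :=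
    Polynomial.funext fun t => by simpa [Polynomial.eval_finsetSum] using h t
  have hcoeff : ∀ w : ℕ → R,
      (∑ m ∈ range (N + 1), Polynomial.monomial (N - m) (w m)).coeff (N - k) = w k := by
    intro w
    rw [Polynomial.finsetSum_coeff, sum_eq_single_of_mem k (mem_range.2 (by lia))]
    · simp
    · intro m hm hmk
      rw [mem_range] at hm
      exact Polynomial.coeff_monomial_of_ne _ (by lia)
  rw [← hcoeff u, hpoly, hcoeff v]

/-- For nodes symmetric about the midpoint of `[a, b]`, reflecting the interval exchanges the
Lagrange basis polynomials of indices `i` and `i.rev`. -/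
lemma lagrange_basis_reflect {K : Type*} [Field K] {N : ℕ} {a b : K} {x : Fin (N + 1) → K}
    (hsymm : ∀ i, x i - a = b - x i.rev) (i : Fin (N + 1)) (t : K) :
    ∏ j ∈ univ.erase i, (t + a - x j) / (x i - x j) =
      ∏ j ∈ univ.erase i.rev, (-t + b - x j) / (x i.rev - x j) := by
  refine prod_equiv Fin.revPerm (by simp) fun j _ => ?_
  rw [Fin.revPerm_apply, ← neg_div_neg_eq]
  congr 1
  · linear_combination hsymm j
  · linear_combination hsymm j - hsymm i

/-- **Rotation symmetry of the Caputo spectral differentiation matrices**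
(Proposition 1 (2), Caputo case).  If the distinct nodes `x_0,…,x_N ⊆ [a,b]`
satisfy `x_i - a = b - x_{N-i}`, then the left Caputo differentiation matrix
`_L^CD_{ji}^{(α)} = Σ_{k=0}^{N-n} c_{i,k} (Γ(N-k+1)/Γ(N-k+1-α)) (x_j-a)^(N-k-α)`
and the right one
`_R^CD_{ji}^{(α)} = Σ_{k=0}^{N-n} d_{i,k} (-1)^(N-k) (Γ(N-k+1)/Γ(N-k+1-α)) (b-x_j)^(N-k-α)`
satisfy `_L^CD_{ji}^{(α)} = _R^CD_{N-j,N-i}^{(α)}`. -/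
theorem Caputo_differentiation_matrix_rotation (a b : ℝ) (hab : a < b)
    (N : ℕ) (hN : 1 ≤ N) (n : ℕ) (hn : 0 < n)
    (α : ℝ) (hα₁ : (n : ℝ) - 1 < α) (hα₂ : α < n) (hnN : n ≤ N)
    (x : Fin (N + 1) → ℝ) (hinj : Function.Injective x)
    (hmem : ∀ i, x i ∈ Set.Icc a b)
    (hsymm : ∀ i : Fin (N + 1), x i - a = b - x i.rev)
    (c d : Fin (N + 1) → ℕ → ℝ)
    (hc : ∀ i, ∀ y : ℝ,
      (∏ j ∈ univ.erase i, (y - x j) / (x i - x j)) =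
        ∑ k ∈ Finset.range (N + 1), c i k * (y - a) ^ (N - k))
    (hd : ∀ i, ∀ y : ℝ,
      (∏ j ∈ univ.erase i, (y - x j) / (x i - x j)) =
        ∑ k ∈ Finset.range (N + 1), d i k * (y - b) ^ (N - k))
    (LCD RCD : Fin (N + 1) → Fin (N + 1) → ℝ)
    (hLCD : ∀ j i, LCD j i = ∑ k ∈ Finset.range (N - n + 1),
      c i k * (Real.Gamma ((N : ℝ) - k + 1) / Real.Gamma ((N : ℝ) - k + 1 - α)) *
        (x j - a) ^ ((N : ℝ) - k - α))
    (hRCD : ∀ j i, RCD j i = ∑ k ∈ Finset.range (N - n + 1),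
      d i k * (-1 : ℝ) ^ (N - k) *
        (Real.Gamma ((N : ℝ) - k + 1) / Real.Gamma ((N : ℝ) - k + 1 - α)) *
        (b - x j) ^ ((N : ℝ) - k - α)) :
    ∀ j i : Fin (N + 1), LCD j i = RCD j.rev i.rev := by
  intro j i
  have hcd : ∀ k ≤ N, c i k = d i.rev k * (-1 : ℝ) ^ (N - k) := by
    intro k hk
    refine coeff_eq_of_forall_sum_mul_pow_sub_eq
      (v := fun k => d i.rev k * (-1 : ℝ) ^ (N - k)) (fun t => ?_) hk
    have hl := hc i (t + a)
    have hr := hd i.rev (-t + b)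
    rw [lagrange_basis_reflect hsymm, hr] at hl
    simpa [neg_pow t, mul_assoc] using hl.symm
  rw [hLCD, hRCD]
  refine sum_congr rfl fun k hk => ?_
  rw [mem_range] at hk
  rw [hcd k (by lia), hsymm j]
end

section
/- Fix an integer N ≥ 2, a real number α with 1 < α < 2, and p, q ≥ 0 with p + q = 1. Let P_N be the Legendre polynomial of degree N, let -1 = x_0 < x_1 < … < x_N = 1 be the N+1 roots of (1-x²)P_N'(x), and let w_i = 2/(N(N+1)P_N(x_i)²). Then there exists a constant C > 0, depending only on N, α, p, q, such that for every real polynomial u of degree at most N with u(-1) = u(1) = 0, Σ_{i=1}^{N-1} (∇^α u(x_i)) u(x_i) w_i ≤ C Σ_{i=0}^N u(x_i)² w_i, where ∇^α u(x) = p·(1/Γ(2-α))(d/dx)² ∫_{-1}^x u(ξ)(x-ξ)^{1-α} dξ + q·(1/Γ(2-α))(d/dx)² ∫_x^1 u(ξ)(ξ-x)^{1-α} dξ. -/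
open Finset Polynomial

/-- The Legendre polynomial of degree `N`, via the Rodrigues formula
`P_N(x) = (1/(2^N N!)) (d/dx)^N (x²-1)^N`. -/
noncomputable def legendreP (N : ℕ) (x : ℝ) : ℝ :=
  (1 / ((2 : ℝ) ^ N * N.factorial)) * iteratedDeriv N (fun y => (y ^ 2 - 1) ^ N) x

/-- The two-sided Riemann–Liouville fractional operator
`∇^α u = p ‧ _{-1}D_x^α u + q ‧ _xD_1^α u` of order `1 < α < 2` on `[-1,1]`. -/
noncomputable def fracGrad (α p q : ℝ) (u : ℝ → ℝ) (y : ℝ) : ℝ :=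
  p * ((1 / Real.Gamma (2 - α)) *
      iteratedDeriv 2 (fun z => ∫ ξ in (-1 : ℝ)..z, u ξ * (z - ξ) ^ (1 - α)) y) +
  q * ((1 / Real.Gamma (2 - α)) *
      iteratedDeriv 2 (fun z => ∫ ξ in z..(1 : ℝ), u ξ * (ξ - z) ^ (1 - α)) y)

/-- The `(k+1)`-fold derivative of the identity `(x² - 1) u' = 2 N x u` for `u = (x² - 1)^N`. -/
lemma iterate_derivative_X_sq_sub_one_pow_recurrence (N k : ℕ) :
    (X ^ 2 - 1 : ℝ[X]) * derivative^[k + 2] ((X ^ 2 - 1) ^ N) +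
      C (2 * ((k : ℝ) + 1 - N)) * X * derivative^[k + 1] ((X ^ 2 - 1) ^ N) +
      C (((k : ℝ) + 1) * (k - 2 * N)) * derivative^[k] ((X ^ 2 - 1) ^ N) = 0 := by
  induction k with
  | zero =>
    have h : (X ^ 2 - 1 : ℝ[X]) * derivative ((X ^ 2 - 1) ^ N) =
        C (2 * (N : ℝ)) * X * (X ^ 2 - 1) ^ N := by
      rcases N with _ | n
      · simp
      · simp [derivative_pow]
        ring
    have h' := congrArg derivative h
    simp only [derivative_mul, derivative_sub, derivative_X_pow, derivative_one, derivative_C,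
      derivative_X] at h'
    simp only [Function.iterate_succ, Function.iterate_zero, Function.comp_apply, id]
    simp only [map_mul, map_sub, map_add, map_natCast, map_ofNat, map_one, Nat.cast_zero,
      map_zero] at h' ⊢
    push_cast at h'
    linear_combination h'
  | succ k ih =>
    have h' := congrArg derivative ih
    simp only [derivative_add, derivative_mul, derivative_sub, derivative_X_pow, derivative_one,
      derivative_C, derivative_X, derivative_zero, ← Function.iterate_succ_apply'] at h'
    simp only [map_mul, map_sub, map_add, map_natCast, map_ofNat, map_one] at h' ⊢
    push_cast at h' ⊢
    linear_combination h'

lemma iteratedDeriv_polynomial_eval (f : ℝ[X]) (n : ℕ) :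
    iteratedDeriv n (fun y => f.eval y) = fun y => (derivative^[n] f).eval y := by
  induction n with
  | zero => simp
  | succ n ih =>
    rw [iteratedDeriv_succ, ih, Function.iterate_succ_apply']
    ext y
    exact Polynomial.deriv _

lemma legendreP_eq_eval (N : ℕ) :
    legendreP N = fun x =>
      (C (1 / ((2 : ℝ) ^ N * N.factorial)) * derivative^[N] ((X ^ 2 - 1) ^ N)).eval x := by
  ext x
  have h := congrFun (iteratedDeriv_polynomial_eval ((X ^ 2 - 1) ^ N) N) x
  simp only [eval_pow, eval_sub, eval_X, eval_one] at h
  rw [legendreP, h, eval_mul, eval_C]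

/-- The Legendre polynomial does not vanish at the Legendre–Gauss–Lobatto points. -/
lemma legendreP_ne_zero_of_lobatto {N : ℕ} {c : ℝ}
    (hc : (1 - c ^ 2) * deriv (legendreP N) c = 0) : legendreP N c ≠ 0 := by
  intro h0
  have hK : (1 / ((2 : ℝ) ^ N * N.factorial)) ≠ 0 := by positivity
  set D : ℕ → ℝ := fun k => (derivative^[k] ((X ^ 2 - 1 : ℝ[X]) ^ N)).eval c with hD
  have hrec (k : ℕ) : (c ^ 2 - 1) * D (k + 2) + 2 * ((k : ℝ) + 1 - N) * c * D (k + 1) +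
      ((k : ℝ) + 1) * (k - 2 * N) * D k = 0 := by
    have h := congrArg (eval c) (iterate_derivative_X_sq_sub_one_pow_recurrence N k)
    simpa only [eval_add, eval_mul, eval_sub, eval_pow, eval_X, eval_one, eval_C, eval_zero] using h
  have hN0 : D N = 0 := by
    simp only [legendreP_eq_eval, eval_mul, eval_C] at h0
    exact (mul_eq_zero.mp h0).resolve_left hK
  have hN1 : (1 - c ^ 2) * D (N + 1) = 0 := by
    rw [legendreP_eq_eval, Polynomial.deriv, derivative_C_mul, eval_mul, eval_C,
      ← Function.iterate_succ_apply' (f := derivative)] at hc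
    rcases mul_eq_zero.mp hc with h | h
    · rw [h, zero_mul]
    · have h' : D (N + 1) = 0 := (mul_eq_zero.mp h).resolve_left hK
      rw [h', mul_zero]
  have hall (m : ℕ) : D (N + m) = 0 ∧ D (N + m + 1) = 0 := by
    by_cases hcc : c ^ 2 - 1 = 0
    · have hc0 : c ≠ 0 := by rintro rfl; norm_num at hcc
      have hstep (m : ℕ) (hm : D (N + m) = 0) : D (N + m + 1) = 0 := by
        have h := hrec (N + m)
        rw [hcc, hm] at h
        push_cast at h
        have h2 : 2 * ((m : ℝ) + 1) * c * D (N + m + 1) = 0 := by linear_combination h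
        have h3 : 2 * ((m : ℝ) + 1) * c ≠ 0 := mul_ne_zero (by positivity) hc0
        exact (mul_eq_zero.mp h2).resolve_left h3
      have h (m : ℕ) : D (N + m) = 0 := by
        induction m with
        | zero => exact hN0
        | succ m ih => exact hstep m ih
      exact ⟨h m, h (m + 1)⟩
    · induction m with
      | zero =>
        refine ⟨hN0, (mul_eq_zero.mp hN1).resolve_left fun h => hcc ?_⟩
        linear_combination -h
      | succ m ih =>
        refine ⟨ih.2, ?_⟩
        have h := hrec (N + m)
        rw [ih.1, ih.2, mul_zero, mul_zero, add_zero, add_zero] at h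
        exact (mul_eq_zero.mp h).resolve_left hcc
  have hmonic : ((X ^ 2 - 1 : ℝ[X]) ^ N).Monic :=
    (monic_X_pow_sub_C (1 : ℝ) two_ne_zero).pow N
  have hdeg : ((X ^ 2 - 1 : ℝ[X]) ^ N).natDegree = N + N := by
    rw [natDegree_pow, ← C_1, natDegree_X_pow_sub_C]
    ring
  have hconst : derivative^[N + N] ((X ^ 2 - 1 : ℝ[X]) ^ N) = C (((N + N).factorial : ℝ)) := by
    have hd := natDegree_iterate_derivative ((X ^ 2 - 1 : ℝ[X]) ^ N) (N + N)
    rw [hdeg, Nat.sub_self, Nat.le_zero] at hd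
    rw [eq_C_of_natDegree_eq_zero hd, coeff_iterate_derivative, zero_add, Nat.descFactorial_self,
      ← hdeg, coeff_natDegree, hmonic.leadingCoeff]
    simp
  have h := (hall N).1
  simp only [hD, hconst, eval_C] at h
  exact (Nat.cast_ne_zero.mpr (Nat.factorial_ne_zero _)) h

lemma intervalIntegrable_polynomial_mul_rpow_sub {r : ℝ} (hr : -1 < r) (u : ℝ[X]) (a z : ℝ) :
    IntervalIntegrable (fun ξ => u.eval ξ * (z - ξ) ^ r) MeasureTheory.volume a z := by
  have h := (intervalIntegral.intervalIntegrable_rpow' hr (a := z - a) (b := 0)).comp_sub_left z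
  simp only [sub_sub_cancel, sub_zero] at h
  exact h.continuousOn_mul u.continuous.continuousOn

lemma integral_polynomial_mul_rpow_sub {r : ℝ} (u : ℝ[X]) {z : ℝ} (hz : -1 < z) :
    ∫ ξ in (-1 : ℝ)..z, u.eval ξ * (z - ξ) ^ r =
      (z + 1) ^ (r + 1) * ∫ t in (0 : ℝ)..1, u.eval (-1 + (z + 1) * t) * (1 - t) ^ r := by
  have hz' : 0 < z + 1 := by linarith
  have h := intervalIntegral.smul_integral_comp_add_mul
    (fun ξ => u.eval ξ * (z - ξ) ^ r) (z + 1) (-1) (a := 0) (b := 1)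
  rw [show -1 + (z + 1) * 0 = -1 by ring, show -1 + (z + 1) * 1 = z by ring] at h
  rw [← h, Real.rpow_add_one hz'.ne', mul_comm ((z + 1) ^ r), mul_assoc, smul_eq_mul,
    ← intervalIntegral.integral_const_mul ((z + 1) ^ r)]
  congr 1
  refine intervalIntegral.integral_congr fun t ht => ?_
  rw [Set.uIcc_of_le zero_le_one] at ht
  rw [show z - (-1 + (z + 1) * t) = (z + 1) * (1 - t) by ring,
    Real.mul_rpow hz'.le (by linarith [ht.2])]
  ring

lemma contDiff_integral_polynomial_mul_rpow {r : ℝ} (hr : -1 < r) (u : ℝ[X]) {n : WithTop ℕ∞} :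
    ContDiff ℝ n (fun z => ∫ t in (0 : ℝ)..1, u.eval (-1 + (z + 1) * t) * (1 - t) ^ r) := by
  set v := u.comp (X - 1) with hv
  have h (z : ℝ) : ∫ t in (0 : ℝ)..1, u.eval (-1 + (z + 1) * t) * (1 - t) ^ r =
      ∑ k ∈ range (v.natDegree + 1),
        v.coeff k * (∫ t in (0 : ℝ)..1, t ^ k * (1 - t) ^ r) * (z + 1) ^ k := by
    have hint (k : ℕ) : IntervalIntegrable (fun t : ℝ => t ^ k * (1 - t) ^ r)
        MeasureTheory.volume 0 1 := by
      simpa using intervalIntegrable_polynomial_mul_rpow_sub hr (X ^ k) 0 1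
    calc _ = ∫ t in (0 : ℝ)..1, ∑ k ∈ range (v.natDegree + 1),
          v.coeff k * (z + 1) ^ k * (t ^ k * (1 - t) ^ r) := by
          congr 1 with t
          have hu : u.eval (-1 + (z + 1) * t) = v.eval ((z + 1) * t) := by
            rw [hv, eval_comp]
            congr 1
            simp
            ring
          rw [hu, eval_eq_sum_range, sum_mul]
          refine sum_congr rfl fun k _ => ?_
          rw [mul_pow]
          ring
      _ = _ := by
          rw [intervalIntegral.integral_finsetSum fun k _ => (hint k).const_mul _]
          refine sum_congr rfl fun k _ => ?_
          rw [intervalIntegral.integral_const_mul]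
          ring
  simp_rw [h]
  fun_prop

lemma contDiffAt_left_integral {r : ℝ} (hr : -1 < r) (u : ℝ[X]) {y : ℝ} (hy : -1 < y)
    {n : WithTop ℕ∞} :
    ContDiffAt ℝ n (fun z => ∫ ξ in (-1 : ℝ)..z, u.eval ξ * (z - ξ) ^ r) y := by
  have hy' : y + 1 ≠ 0 := by linarith
  have h : ContDiffAt ℝ n (fun z : ℝ => (z + 1) ^ (r + 1)) y :=
    (contDiffAt_id.add contDiffAt_const).rpow_const_of_ne hy'
  refine (h.mul (contDiff_integral_polynomial_mul_rpow hr u).contDiffAt).congr_of_eventuallyEq ?_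
  filter_upwards [lt_mem_nhds hy] with z hz using integral_polynomial_mul_rpow_sub u hz

lemma right_integral_eq_left_integral {r : ℝ} (u : ℝ[X]) (z : ℝ) :
    ∫ ξ in z..(1 : ℝ), u.eval ξ * (ξ - z) ^ r =
      ∫ ξ in (-1 : ℝ)..(-z), (u.comp (-X)).eval ξ * (-z - ξ) ^ r := by
  rw [← neg_neg z, ← neg_neg (1 : ℝ),
    ← intervalIntegral.integral_comp_neg (fun ξ => u.eval ξ * (ξ - - -z) ^ r)]
  simp only [neg_neg, eval_comp, eval_neg, eval_X]
  congr 1 with ξ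
  ring_nf

lemma intervalIntegrable_polynomial_mul_rpow_sub_right {r : ℝ} (hr : -1 < r) (u : ℝ[X])
    (z b : ℝ) :
    IntervalIntegrable (fun ξ => u.eval ξ * (ξ - z) ^ r) MeasureTheory.volume z b := by
  have h := (intervalIntegral.intervalIntegrable_rpow' hr (a := 0) (b := b - z)).comp_sub_right z
  simp only [sub_add_cancel, zero_add] at h
  exact h.continuousOn_mul u.continuous.continuousOn

lemma contDiffAt_right_integral {r : ℝ} (hr : -1 < r) (u : ℝ[X]) {y : ℝ} (hy : y < 1)
    {n : WithTop ℕ∞} :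
    ContDiffAt ℝ n (fun z => ∫ ξ in z..(1 : ℝ), u.eval ξ * (ξ - z) ^ r) y := by
  simp_rw [right_integral_eq_left_integral]
  exact (contDiffAt_left_integral hr (u.comp (-X)) (neg_lt_neg hy)).comp y
    contDiff_neg.contDiffAt

lemma fracGrad_add {α : ℝ} (hα : α < 2) (p q : ℝ) {y : ℝ} (hy : y ∈ Set.Ioo (-1 : ℝ) 1)
    (u v : ℝ[X]) :
    fracGrad α p q (fun t => (u + v).eval t) y =
      fracGrad α p q (fun t => u.eval t) y + fracGrad α p q (fun t => v.eval t) y := by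
  have hr : -1 < 1 - α := by linarith
  have hl : (fun z => ∫ ξ in (-1 : ℝ)..z, (u + v).eval ξ * (z - ξ) ^ (1 - α)) =
      (fun z => ∫ ξ in (-1 : ℝ)..z, u.eval ξ * (z - ξ) ^ (1 - α)) +
        fun z => ∫ ξ in (-1 : ℝ)..z, v.eval ξ * (z - ξ) ^ (1 - α) := by
    ext z
    simp only [eval_add, add_mul, Pi.add_apply]
    exact intervalIntegral.integral_add (intervalIntegrable_polynomial_mul_rpow_sub hr u _ _)
      (intervalIntegrable_polynomial_mul_rpow_sub hr v _ _)
  have hR : (fun z => ∫ ξ in z..(1 : ℝ), (u + v).eval ξ * (ξ - z) ^ (1 - α)) =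
      (fun z => ∫ ξ in z..(1 : ℝ), u.eval ξ * (ξ - z) ^ (1 - α)) +
        fun z => ∫ ξ in z..(1 : ℝ), v.eval ξ * (ξ - z) ^ (1 - α) := by
    ext z
    simp only [eval_add, add_mul, Pi.add_apply]
    exact intervalIntegral.integral_add
      (intervalIntegrable_polynomial_mul_rpow_sub_right hr u _ _)
      (intervalIntegrable_polynomial_mul_rpow_sub_right hr v _ _)
  simp only [fracGrad]
  rw [hl, hR,
    iteratedDeriv_add (contDiffAt_left_integral hr u hy.1) (contDiffAt_left_integral hr v hy.1),
    iteratedDeriv_add (contDiffAt_right_integral hr u hy.2) (contDiffAt_right_integral hr v hy.2)]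
  ring

lemma fracGrad_const_mul (α p q c : ℝ) (f : ℝ → ℝ) (y : ℝ) :
    fracGrad α p q (fun t => c * f t) y = c * fracGrad α p q f y := by
  simp only [fracGrad, mul_assoc c, intervalIntegral.integral_const_mul,
    iteratedDeriv_const_mul_field]
  ring

/-- The fractional operator at an interior point, as a linear functional on polynomials. -/
noncomputable def fracGradLinear {α : ℝ} (hα : α < 2) (p q : ℝ) {y : ℝ}
    (hy : y ∈ Set.Ioo (-1 : ℝ) 1) : ℝ[X] →ₗ[ℝ] ℝ where
  toFun u := fracGrad α p q (fun t => u.eval t) y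
  map_add' u v := fracGrad_add hα p q hy u v
  map_smul' c u := by
    simpa using fracGrad_const_mul α p q c (fun t => u.eval t) y

/-- A bilinear form in the nodal values is bounded by any positively weighted discrete norm. -/
lemma exists_bound_bilinear_nodal {ι : Type*} [Fintype ι] (w : ι → ℝ) (hw : ∀ i, 0 < w i)
    (M : ι → ι → ℝ) :
    ∃ C > 0, ∀ a : ι → ℝ, ∑ i, ∑ j, M i j * a i * a j ≤ C * ∑ i, a i ^ 2 * w i := by
  refine ⟨1 + ∑ i, ∑ j, |M i j| * ((w i)⁻¹ + (w j)⁻¹), ?_, fun a => ?_⟩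
  · have : 0 ≤ ∑ i, ∑ j, |M i j| * ((w i)⁻¹ + (w j)⁻¹) :=
      sum_nonneg fun i _ => sum_nonneg fun j _ =>
        mul_nonneg (abs_nonneg _) (add_nonneg (inv_pos.2 (hw i)).le (inv_pos.2 (hw j)).le)
    linarith
  set S := ∑ i, a i ^ 2 * w i with hS
  have hterm (i : ι) : 0 ≤ a i ^ 2 * w i := mul_nonneg (sq_nonneg _) (hw i).le
  have hS0 : 0 ≤ S := sum_nonneg fun i _ => hterm i
  have hle (i : ι) : a i ^ 2 ≤ (w i)⁻¹ * S := by
    rw [inv_mul_eq_div, le_div_iff₀ (hw i)]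
    exact single_le_sum (f := fun i => a i ^ 2 * w i) (fun i _ => hterm i) (mem_univ i)
  have hmain : ∑ i, ∑ j, M i j * a i * a j ≤
      (∑ i, ∑ j, |M i j| * ((w i)⁻¹ + (w j)⁻¹)) * S := by
    simp_rw [sum_mul]
    refine sum_le_sum fun i _ => sum_le_sum fun j _ => ?_
    have hab : |a i * a j| ≤ ((w i)⁻¹ + (w j)⁻¹) * S := by
      have h := hle i
      have h' := hle j
      rw [abs_le]
      constructor <;> nlinarith [sq_nonneg (a i + a j), sq_nonneg (a i - a j)]
    calc M i j * a i * a j ≤ |M i j * (a i * a j)| := by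
          rw [mul_assoc]; exact le_abs_self _
      _ = |M i j| * |a i * a j| := abs_mul _ _
      _ ≤ |M i j| * (((w i)⁻¹ + (w j)⁻¹) * S) := by gcongr
      _ = _ := by ring
  linarith

/-- **Discrete bound for the fractional bilinear term** (inequality (28) of
the paper): on the Legendre–Gauss–Lobatto nodes `-1 = x_0 < … < x_N = 1`
(the roots of `(1-x²)P_N'(x)`) with weights `w_i = 2/(N(N+1)P_N(x_i)²)`,
there is a constant `C = C(N,α,p,q) > 0` such that for every polynomial `u` of
degree at most `N` with `u(±1) = 0`,
`Σ_{i=1}^{N-1} (∇^α u(x_i)) u(x_i) w_i ≤ C Σ_{i=0}^N u(x_i)² w_i`. -/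
theorem discrete_fracGrad_inner_bound (N : ℕ) (hN : 2 ≤ N)
    (α : ℝ) (hα₁ : 1 < α) (hα₂ : α < 2)
    (p q : ℝ) (hp : 0 ≤ p) (hq : 0 ≤ q) (hpq : p + q = 1)
    (x : Fin (N + 1) → ℝ) (hx : StrictMono x)
    (hx0 : x 0 = -1) (hxN : x (Fin.last N) = 1)
    (hroot : ∀ i, (1 - x i ^ 2) * deriv (legendreP N) (x i) = 0)
    (w : Fin (N + 1) → ℝ)
    (hw : ∀ i, w i = 2 / ((N : ℝ) * (N + 1) * legendreP N (x i) ^ 2)) :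
    ∃ C > 0, ∀ u : Polynomial ℝ, u.natDegree ≤ N →
      u.eval (-1) = 0 → u.eval 1 = 0 →
      ∑ i ∈ univ.filter (fun i : Fin (N + 1) => i ≠ 0 ∧ i ≠ Fin.last N),
          (fracGrad α p q (fun t => u.eval t) (x i)) * u.eval (x i) * w i ≤
        C * ∑ i : Fin (N + 1), u.eval (x i) ^ 2 * w i := by
  have hxinj : Set.InjOn x (univ : Finset (Fin (N + 1))) := hx.injective.injOn
  have hN' : (0 : ℝ) < N := by exact_mod_cast (by omega : 0 < N)
  have hwpos (i : Fin (N + 1)) : 0 < w i := by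
    have := legendreP_ne_zero_of_lobatto (hroot i)
    rw [hw]
    positivity
  have hmem (i : Fin (N + 1)) (hi : i ≠ 0 ∧ i ≠ Fin.last N) : x i ∈ Set.Ioo (-1 : ℝ) 1 :=
    ⟨hx0 ▸ hx (Fin.pos_iff_ne_zero.mpr hi.1), hxN ▸ hx (Fin.lt_last_iff_ne_last.mpr hi.2)⟩
  obtain ⟨K, hK, hbound⟩ := exists_bound_bilinear_nodal w hwpos fun i j =>
    if i ≠ 0 ∧ i ≠ Fin.last N then
      fracGrad α p q (fun t => (Lagrange.basis univ x j).eval t) (x i) * w i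
    else 0
  refine ⟨K, hK, fun u hu _ _ => le_trans (le_of_eq ?_) (hbound fun i => u.eval (x i))⟩
  rw [sum_filter]
  refine sum_congr rfl fun i _ => ?_
  split_ifs with hi
  · have hdeg : u.degree < (univ : Finset (Fin (N + 1))).card := by
      rw [card_univ, Fintype.card_fin]
      exact (degree_le_of_natDegree_le hu).trans_lt (by exact_mod_cast N.lt_succ_self)
    have hval : fracGrad α p q (fun t => u.eval t) (x i) =
        ∑ j, u.eval (x j) * fracGrad α p q (fun t => (Lagrange.basis univ x j).eval t) (x i) := by
      have h := congrArg (fracGradLinear hα₂ p q (hmem i hi)) (Lagrange.eq_interpolate hxinj hdeg)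
      simp only [Lagrange.interpolate_apply, ← smul_eq_C_mul, map_sum, map_smul,
        smul_eq_mul] at h
      exact h
    rw [hval, sum_mul, sum_mul]
    refine sum_congr rfl fun j _ => ?_
    ring
  · simp
end

section
/- (Stability of the semi-discrete Legendre collocation scheme.) Fix an integer N ≥ 2, a real number α with 1 < α < 2, constants κ_α > 0, ν_α > 0, and p, q ≥ 0 with p + q = 1. Let P_N be the Legendre polynomial of degree N, let -1 = x_0 < … < x_N = 1 be the roots of (1-x²)P_N'(x), let w_i = 2/(N(N+1)P_N(x_i)²), and write (u,v)_N = Σ_{i=0}^N u(x_i)v(x_i)w_i and ‖u‖_N = √((u,u)_N). Then there exists a constant C > 0, depending only on N, α, κ_α, p, q, with the following property: if u_N : [0,∞) × [-1,1] → ℝ is such that for each t the function u_N(·,t) is a polynomial of degree at most N with u_N(-1,t) = u_N(1,t) = 0, the nodal values t ↦ u_N(x_j,t) are continuously differentiable, f(·,t) is a continuous family of nodal data, and for all t > 0 and all polynomials v of degree at most N with v(±1)=0 one has (∂u_N/∂t (·,t), v)_N = κ_α (∇^α u_N(·,t), v)_N − ν_α (∂u_N/∂x (·,t), v)_N + (f(·,t),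 v)_N, then for all T > 0, ‖u_N(·,T)‖_N² ≤ exp(CT)·(‖u_N(·,0)‖_N² + ∫_0^T ‖f(·,t)‖_N² dt). -/
open Finset Polynomial

/-- The left-sided Abel integral of a polynomial on `[-1, z]`. -/
noncomputable def abelIntegral (β : ℝ) (u : ℝ[X]) (z : ℝ) : ℝ :=
  ∫ ξ in (-1 : ℝ)..z, u.eval ξ * (z - ξ) ^ β

lemma intervalIntegrable_eval_mul_rpow {β : ℝ} (hβ : -1 < β) (u : ℝ[X]) (a b z : ℝ) :
    IntervalIntegrable (fun ξ => u.eval ξ * (z - ξ) ^ β) MeasureTheory.volume a b := by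
  have h : IntervalIntegrable (fun ξ : ℝ => (z - ξ) ^ β) MeasureTheory.volume a b := by
    have := (intervalIntegral.intervalIntegrable_rpow' (a := z - a) (b := z - b) hβ).comp_sub_left z
    simpa using this
  exact h.continuousOn_mul u.continuous.continuousOn

lemma abelIntegral_add {β : ℝ} (hβ : -1 < β) (u v : ℝ[X]) :
    abelIntegral β (u + v) = fun z => abelIntegral β u z + abelIntegral β v z := by
  funext z
  simp only [abelIntegral]
  rw [← intervalIntegral.integral_add (intervalIntegrable_eval_mul_rpow hβ u _ _ z)
    (intervalIntegrable_eval_mul_rpow hβ v _ _ z)]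
  simp only [eval_add, add_mul]

lemma abelIntegral_smul (β c : ℝ) (u : ℝ[X]) :
    abelIntegral β (c • u) = fun z => c * abelIntegral β u z := by
  funext z
  simp only [abelIntegral, ← intervalIntegral.integral_const_mul, eval_smul, smul_eq_mul, mul_assoc]

lemma abelIntegral_X_add_one_pow (β : ℝ) (k : ℕ) {z : ℝ} (hz : -1 < z) :
    abelIntegral β ((X + 1) ^ k) z =
      (z + 1) ^ (k + 1) * (z + 1) ^ β * ∫ s in (0 : ℝ)..1, s ^ k * (1 - s) ^ β := by
  have h := intervalIntegral.mul_integral_comp_mul_add (a := 0) (b := 1)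
    (f := fun ξ : ℝ => (ξ + 1) ^ k * (z - ξ) ^ β) (z + 1) (-1)
  simp only [mul_zero, zero_add, mul_one, add_neg_cancel_right] at h
  simp only [abelIntegral, eval_pow, eval_add, eval_X, eval_one]
  rw [← h, pow_succ', mul_assoc, mul_assoc,
    ← intervalIntegral.integral_const_mul ((z + 1) ^ β)]
  rw [← intervalIntegral.integral_const_mul ((z + 1) ^ k)]
  congr 1
  refine intervalIntegral.integral_congr fun s hs => ?_
  rw [Set.uIcc_of_le zero_le_one] at hs
  rw [show (z + 1) * s + -1 + 1 = (z + 1) * s by ring,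
    show z - ((z + 1) * s + -1) = (z + 1) * (1 - s) by ring, mul_pow,
    Real.mul_rpow (by linarith) (by linarith [hs.2])]
  ring

lemma contDiffAt_abelIntegral {β : ℝ} (hβ : -1 < β) (u : ℝ[X]) {y : ℝ} (hy : -1 < y) :
    ContDiffAt ℝ 2 (abelIntegral β u) y := by
  have key : ∀ w : ℝ[X], ContDiffAt ℝ 2 (abelIntegral β (w.comp (X + 1))) y := by
    intro w
    induction w using Polynomial.induction_on' with
    | add p q hp hq =>
      rw [add_comp, abelIntegral_add hβ]
      exact hp.add hq
    | monomial k a =>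
      have hmon : (monomial k a).comp (X + 1 : ℝ[X]) = a • (X + 1) ^ k := by
        simp [smul_eq_C_mul]
      rw [hmon, abelIntegral_smul]
      refine contDiffAt_const.mul ?_
      have hev : abelIntegral β ((X + 1) ^ k) =ᶠ[nhds y] fun z =>
          (z + 1) ^ (k + 1) * (z + 1) ^ β * ∫ s in (0 : ℝ)..1, s ^ k * (1 - s) ^ β := by
        filter_upwards [lt_mem_nhds hy] with z hz using abelIntegral_X_add_one_pow β k hz
      refine ContDiffAt.congr_of_eventuallyEq ?_ hev
      have h1 : ContDiffAt ℝ 2 (fun z : ℝ => z + 1) y := contDiffAt_id.add contDiffAt_const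
      exact ((h1.pow _).mul (h1.rpow_const_of_ne (by linarith))).mul contDiffAt_const
  have hu : (u.comp (X - 1)).comp (X + 1) = u := by
    rw [comp_assoc, sub_comp, X_comp, one_comp, add_sub_cancel_right, comp_X]
  exact hu ▸ key (u.comp (X - 1))

lemma integral_eval_mul_rpow_right (β : ℝ) (u : ℝ[X]) :
    (fun z => ∫ ξ in z..(1 : ℝ), u.eval ξ * (ξ - z) ^ β) =
      fun z => abelIntegral β (u.comp (-X)) (-z) := by
  funext z
  rw [abelIntegral, ← intervalIntegral.integral_comp_neg]
  simp [neg_add_eq_sub]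

/-- At interior points, the fractional operator is a linear functional on polynomials. -/
lemma exists_linearMap_eq_fracGrad {α : ℝ} (hα : α < 2) (p q : ℝ) {y : ℝ}
    (hy₁ : -1 < y) (hy₂ : y < 1) :
    ∃ L : ℝ[X] →ₗ[ℝ] ℝ, ∀ u : ℝ[X], fracGrad α p q (fun s => u.eval s) y = L u := by
  have hβ : -1 < 1 - α := by linarith
  have hform : ∀ u : ℝ[X], fracGrad α p q (fun s => u.eval s) y =
      p * ((1 / Real.Gamma (2 - α)) * iteratedDeriv 2 (abelIntegral (1 - α) u) y) +
      q * ((1 / Real.Gamma (2 - α)) *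
        iteratedDeriv 2 (abelIntegral (1 - α) (u.comp (-X))) (-y)) := by
    intro u
    rw [fracGrad, integral_eval_mul_rpow_right, iteratedDeriv_comp_neg]
    simp only [even_two, Even.neg_pow, one_pow, one_smul]
    rfl
  have hy₃ : -1 < -y := by linarith
  refine ⟨{ toFun := fun u => fracGrad α p q (fun s => u.eval s) y
            map_add' := fun u v => ?_
            map_smul' := fun c u => ?_ }, fun u => rfl⟩
  · simp only [hform, add_comp, abelIntegral_add hβ]
    rw [iteratedDeriv_fun_add (contDiffAt_abelIntegral hβ _ hy₁) (contDiffAt_abelIntegral hβ _ hy₁),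
      iteratedDeriv_fun_add (contDiffAt_abelIntegral hβ _ hy₃) (contDiffAt_abelIntegral hβ _ hy₃)]
    ring
  · simp only [hform, smul_comp, abelIntegral_smul, iteratedDeriv_const_mul_field,
      RingHom.id_apply, smul_eq_mul]
    ring

/-- The Legendre polynomial of degree `N` as a polynomial. -/
noncomputable def legendrePoly (N : ℕ) : ℝ[X] :=
  C (1 / ((2 : ℝ) ^ N * N.factorial)) * derivative^[N] ((X ^ 2 - 1) ^ N)

lemma iteratedDeriv_eval (n : ℕ) (p : ℝ[X]) :
    iteratedDeriv n (fun x => p.eval x) = fun x => (derivative^[n] p).eval x := by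
  induction n with
  | zero => simp
  | succ n ih =>
    rw [iteratedDeriv_succ, ih, Function.iterate_succ_apply']
    funext x
    exact Polynomial.deriv _

lemma legendreP_eq_eval_s18 (N : ℕ) : legendreP N = fun x => (legendrePoly N).eval x := by
  funext x
  have h := congrFun (iteratedDeriv_eval N ((X ^ 2 - 1) ^ N)) x
  simp only [eval_pow, eval_sub, eval_X, eval_one] at h
  simp [legendreP, legendrePoly, h]

lemma natDegree_X_sq_sub_one_pow (N : ℕ) : ((X ^ 2 - 1 : ℝ[X]) ^ N).natDegree = 2 * N := by
  rw [natDegree_pow, ← C_1, natDegree_X_pow_sub_C, mul_comm]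

lemma natDegree_legendrePoly (N : ℕ) : (legendrePoly N).natDegree = N := by
  have hmonic : ((X ^ 2 - 1 : ℝ[X]) ^ N).Monic := by
    rw [← C_1]
    exact (monic_X_pow_sub_C 1 two_ne_zero).pow N
  apply natDegree_eq_of_le_of_coeff_ne_zero
  · refine (natDegree_C_mul_le _ _).trans ((natDegree_iterate_derivative _ _).trans ?_)
    rw [natDegree_X_sq_sub_one_pow]
    lia
  · have hc : ((X ^ 2 - 1 : ℝ[X]) ^ N).coeff (N + N) = 1 := by
      have := hmonic.coeff_natDegree
      rwa [natDegree_X_sq_sub_one_pow, two_mul] at this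
    rw [legendrePoly, coeff_C_mul, coeff_iterate_derivative, hc]
    have : (N + N).descFactorial N ≠ 0 := by
      rw [Ne, Nat.descFactorial_eq_zero_iff_lt]
      lia
    simp only [nsmul_eq_mul, mul_one]
    have h2 : (((N + N).descFactorial N : ℕ) : ℝ) ≠ 0 := by exact_mod_cast this
    positivity

lemma iterate_derivative_X_sq_sub_one_pow (N k : ℕ) :
    (X ^ 2 - 1) * derivative^[k + 2] ((X ^ 2 - 1 : ℝ[X]) ^ N)
      + C (2 * ((k : ℝ) + 1 - N)) * X * derivative^[k + 1] ((X ^ 2 - 1 : ℝ[X]) ^ N)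
      + C (((k : ℝ) + 1) * (k - 2 * N)) * derivative^[k] ((X ^ 2 - 1 : ℝ[X]) ^ N) = 0 := by
  induction k with
  | zero =>
    have h : (X ^ 2 - 1) * derivative ((X ^ 2 - 1 : ℝ[X]) ^ N) =
        C (2 * (N : ℝ)) * X * (X ^ 2 - 1) ^ N := by
      rcases N with _ | N
      · simp
      · rw [derivative_pow_succ]
        simp [C_ofNat]
        ring
    have h' := congrArg derivative h
    simp only [derivative_mul, derivative_C, derivative_X, derivative_sub, derivative_one,
      derivative_X_pow] at h'
    simp only [Function.iterate_succ_apply', Function.iterate_zero_apply] at h' ⊢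
    simp [C_ofNat] at h' ⊢
    linear_combination h'
  | succ k ih =>
    have h' := congrArg derivative ih
    simp only [derivative_add, derivative_mul, derivative_C, derivative_X, derivative_sub,
      derivative_one, derivative_X_pow, ← Function.iterate_succ_apply' derivative] at h'
    simp [C_ofNat] at h' ⊢
    linear_combination h'

/-- The Legendre differential equation. -/
lemma derivative_one_sub_X_sq_mul_derivative_legendrePoly (N : ℕ) :
    derivative ((1 - X ^ 2) * derivative (legendrePoly N)) =
      C (-((N : ℝ) * (N + 1))) * legendrePoly N := by
  have h := iterate_derivative_X_sq_sub_one_pow N N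
  simp only [Function.iterate_succ_apply'] at h
  simp only [legendrePoly, derivative_mul, derivative_C, derivative_sub, derivative_one,
    derivative_X_pow]
  generalize 1 / ((2 : ℝ) ^ N * N.factorial) = c
  simp [C_ofNat] at h ⊢
  linear_combination -C c * h

/-- Integration over `[-1, 1]` as a linear functional on polynomials. -/
noncomputable def polyIntegral : ℝ[X] →ₗ[ℝ] ℝ where
  toFun p := ∫ x in (-1 : ℝ)..1, p.eval x
  map_add' p q := by
    simp only [eval_add]
    exact intervalIntegral.integral_add (p.continuous.intervalIntegrable _ _)
      (q.continuous.intervalIntegrable _ _)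
  map_smul' c p := by
    simp [eval_smul, intervalIntegral.integral_const_mul]

lemma polyIntegral_derivative (p : ℝ[X]) :
    polyIntegral (derivative p) = p.eval 1 - p.eval (-1) :=
  intervalIntegral.integral_eq_sub_of_hasDerivAt (fun x _ => p.hasDerivAt x)
    (p.derivative.continuous.intervalIntegrable _ _)

lemma polyIntegral_C_mul (c : ℝ) (p : ℝ[X]) : polyIntegral (C c * p) = c * polyIntegral p := by
  rw [← smul_eq_C_mul, map_smul, smul_eq_mul]

lemma polyIntegral_sq_pos {p : ℝ[X]} (hp : p ≠ 0) : 0 < polyIntegral (p * p) := by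
  obtain ⟨c, hc, hpc⟩ : ∃ c ∈ Set.Icc (-1 : ℝ) 1, p.eval c ≠ 0 := by
    by_contra! h
    exact hp (p.eq_zero_of_infinite_isRoot
      ((Set.Icc_infinite (by norm_num : (-1 : ℝ) < 1)).mono h))
  refine intervalIntegral.integral_pos (by norm_num) (p * p).continuous.continuousOn
    (fun x _ => ?_) ⟨c, hc, ?_⟩
  · rw [eval_mul]; exact mul_self_nonneg _
  · rw [eval_mul]; exact mul_self_pos.2 hpc

lemma linearMap_eq_zero_of_natDegree_lt {L : ℝ[X] →ₗ[ℝ] ℝ} {n : ℕ}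
    (hL : ∀ k < n, L (X ^ k) = 0) {p : ℝ[X]} (hp : p.natDegree < n) : L p = 0 := by
  rw [p.as_sum_range' n hp, map_sum]
  refine Finset.sum_eq_zero fun k hk => ?_
  rw [← C_mul_X_pow_eq_monomial, ← smul_eq_C_mul, map_smul, hL k (Finset.mem_range.1 hk), smul_zero]

/-- The nodal polynomial `(1 - X²) P_N'` of the Legendre–Gauss–Lobatto points. -/
noncomputable def lobattoPoly (N : ℕ) : ℝ[X] := (1 - X ^ 2) * derivative (legendrePoly N)

lemma polyIntegral_lobattoPoly_mul_derivative (N : ℕ) (a : ℝ[X]) :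
    polyIntegral (lobattoPoly N * derivative a) =
      (N : ℝ) * (N + 1) * polyIntegral (legendrePoly N * a) := by
  have h := polyIntegral_derivative (lobattoPoly N * a)
  rw [derivative_mul, map_add, lobattoPoly,
    derivative_one_sub_X_sq_mul_derivative_legendrePoly, mul_assoc, polyIntegral_C_mul] at h
  simp at h
  rw [lobattoPoly]
  linarith

lemma polyIntegral_legendrePoly_mul_X_pow {N k : ℕ} (hk : k < N) :
    polyIntegral (legendrePoly N * X ^ k) = 0 := by
  induction k using Nat.strong_induction_on with
  | _ k ih =>
  have h1 := polyIntegral_lobattoPoly_mul_derivative N (X ^ k)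
  have h2 := polyIntegral_derivative (legendrePoly N * ((1 - X ^ 2) * derivative (X ^ k)))
  have h3 : derivative (legendrePoly N * ((1 - X ^ 2) * derivative (X ^ k))) =
      lobattoPoly N * derivative (X ^ k) +
        (C ((k : ℝ) * ((k - 1 : ℕ) : ℝ)) * (legendrePoly N * X ^ (k - 2)) +
        C (-((k : ℝ) * (k + 1))) * (legendrePoly N * X ^ k)) := by
    rcases k with _ | _ | k
    · simp [lobattoPoly]
    · simp [lobattoPoly, derivative_mul]
      ring
    · simp [lobattoPoly, derivative_mul]
      ring
  rw [h3, map_add, map_add, polyIntegral_C_mul, polyIntegral_C_mul, h1] at h2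
  have h4 : (k : ℝ) * ((k - 1 : ℕ) : ℝ) * polyIntegral (legendrePoly N * X ^ (k - 2)) = 0 := by
    rcases k with _ | _ | k
    · simp
    · simp
    · rw [ih _ (by lia) (by lia), mul_zero]
  rw [h4] at h2
  simp at h2
  have hkN : (k : ℝ) < N := by exact_mod_cast hk
  have hk0 : (0 : ℝ) ≤ k := k.cast_nonneg
  have h5 : ((N : ℝ) * (N + 1) - k * (k + 1)) * polyIntegral (legendrePoly N * X ^ k) = 0 := by
    linarith
  exact (mul_eq_zero.1 h5).resolve_left (by nlinarith)

lemma polyIntegral_legendrePoly_mul_eq_zero {N : ℕ} {a : ℝ[X]} (ha : a.natDegree < N) :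
    polyIntegral (legendrePoly N * a) = 0 :=
  linearMap_eq_zero_of_natDegree_lt (L := polyIntegral ∘ₗ LinearMap.mulLeft ℝ (legendrePoly N))
    (fun _ hk => polyIntegral_legendrePoly_mul_X_pow hk) ha

lemma polyIntegral_lobattoPoly_mul_eq_zero {N : ℕ} {a : ℝ[X]} (ha : a.natDegree < N - 1) :
    polyIntegral (lobattoPoly N * a) = 0 := by
  refine linearMap_eq_zero_of_natDegree_lt
    (L := polyIntegral ∘ₗ LinearMap.mulLeft ℝ (lobattoPoly N)) (fun k hk => ?_) ha
  have h := polyIntegral_lobattoPoly_mul_derivative N (C (1 / ((k : ℝ) + 1)) * X ^ (k + 1))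
  have hk1 : ((k : ℝ) + 1) ≠ 0 := by positivity
  have hd : derivative (C (1 / ((k : ℝ) + 1)) * X ^ (k + 1)) = X ^ k := by
    rw [derivative_C_mul_X_pow]
    push_cast
    rw [one_div_mul_cancel hk1]
    simp
  rw [hd, polyIntegral_legendrePoly_mul_eq_zero, mul_zero] at h
  · exact h
  · exact (natDegree_C_mul_X_pow_le _ _).trans_lt (by lia)

lemma natDegree_lt_of_coeff_eq_zero {p : ℝ[X]} {n : ℕ} (hn : 0 < n) (hp : p.natDegree ≤ n)
    (hc : p.coeff n = 0) : p.natDegree < n := by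
  refine lt_of_le_of_ne hp fun h => ?_
  rw [← h, coeff_natDegree, leadingCoeff_eq_zero] at hc
  rw [hc, natDegree_zero] at h
  lia

lemma coeff_derivative_legendrePoly {N : ℕ} (hN : 1 ≤ N) :
    (derivative (legendrePoly N)).coeff (N - 1) = N * (legendrePoly N).coeff N := by
  obtain ⟨n, rfl⟩ : ∃ n, N = n + 1 := ⟨N - 1, by lia⟩
  rw [coeff_derivative]
  push_cast
  simp [mul_comm]

lemma coeff_legendrePoly_ne_zero {N : ℕ} (hN : 1 ≤ N) : (legendrePoly N).coeff N ≠ 0 := by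
  intro h
  have := natDegree_lt_of_coeff_eq_zero hN (natDegree_legendrePoly N).le h
  rw [natDegree_legendrePoly] at this
  exact this.false

lemma natDegree_derivative_legendrePoly_le (N : ℕ) :
    (derivative (legendrePoly N)).natDegree ≤ N - 1 := by
  exact (natDegree_derivative_le _).trans_eq (by rw [natDegree_legendrePoly])

lemma natDegree_lobattoPoly_le {N : ℕ} (hN : 1 ≤ N) : (lobattoPoly N).natDegree ≤ N + 1 := by
  have h1 : (1 - X ^ 2 : ℝ[X]).natDegree ≤ 2 := by compute_degree
  refine natDegree_mul_le.trans ?_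
  have := natDegree_derivative_legendrePoly_le N
  lia

lemma coeff_lobattoPoly {N : ℕ} (hN : 1 ≤ N) :
    (lobattoPoly N).coeff (N + 1) = -(N * (legendrePoly N).coeff N) := by
  have h : (derivative (legendrePoly N)).coeff (N + 1) = 0 :=
    coeff_eq_zero_of_natDegree_lt
      ((natDegree_derivative_legendrePoly_le N).trans_lt (by lia))
  rw [lobattoPoly, sub_mul, one_mul, coeff_sub, h, show N + 1 = (N - 1) + 2 by lia, mul_comm,
    coeff_mul_X_pow, coeff_derivative_legendrePoly hN, zero_sub]

lemma coeff_lobattoPoly_ne_zero {N : ℕ} (hN : 1 ≤ N) : (lobattoPoly N).coeff (N + 1) ≠ 0 := by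
  rw [coeff_lobattoPoly hN]
  have : (N : ℝ) ≠ 0 := by positivity
  exact neg_ne_zero.2 (mul_ne_zero this (coeff_legendrePoly_ne_zero hN))

lemma natDegree_lobattoPoly {N : ℕ} (hN : 1 ≤ N) : (lobattoPoly N).natDegree = N + 1 :=
  natDegree_eq_of_le_of_coeff_ne_zero (natDegree_lobattoPoly_le hN) (coeff_lobattoPoly_ne_zero hN)

lemma natDegree_and_coeff_of_X_sub_C_mul {p R : ℝ[X]} {a : ℝ} {n : ℕ}
    (h : (X - C a) * R = p) (hp : p.natDegree = n + 1) :
    R.natDegree = n ∧ R.coeff n = p.coeff (n + 1) := by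
  have hR : R ≠ 0 := by
    rintro rfl
    rw [mul_zero] at h
    rw [← h, natDegree_zero] at hp
    lia
  have hd : R.natDegree = n := by
    have := natDegree_mul (X_sub_C_ne_zero a) hR
    rw [h, hp, natDegree_X_sub_C] at this
    lia
  refine ⟨hd, ?_⟩
  have hl := leadingCoeff_mul (X - C a) R
  rw [h, leadingCoeff_X_sub_C, one_mul, leadingCoeff, leadingCoeff, hp, hd] at hl
  exact hl.symm

/-- The integral of the cofactor of a root of the Lobatto nodal polynomial. -/
lemma eval_mul_polyIntegral_cofactor {N : ℕ} (hN : 2 ≤ N) {R : ℝ[X]} {a : ℝ}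
    (h : (X - C a) * R = lobattoPoly N) :
    (legendrePoly N).eval a * polyIntegral R =
      -((2 * N + 1) * polyIntegral (legendrePoly N * legendrePoly N)) := by
  set P := legendrePoly N with hP
  have hN0 : (N : ℝ) ≠ 0 := by positivity
  obtain ⟨hRd, hRc⟩ := natDegree_and_coeff_of_X_sub_C_mul h (natDegree_lobattoPoly (by lia))
  rw [coeff_lobattoPoly (by lia), ← hP] at hRc
  have hPd : P.natDegree = N := natDegree_legendrePoly N
  obtain ⟨s, hs⟩ : X - C a ∣ P - C (P.eval a) := by
    rw [dvd_iff_isRoot]; simp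
  have hPd' : (P - C (P.eval a)).natDegree = (N - 1) + 1 := by
    rw [natDegree_sub_C, hPd]; lia
  obtain ⟨hsd, hsc⟩ := natDegree_and_coeff_of_X_sub_C_mul hs.symm hPd'
  have hsc' : s.coeff (N - 1) = P.coeff N := by
    rw [hsc, coeff_sub, coeff_C, if_neg (by lia), sub_zero, show N - 1 + 1 = N by lia]
  have h1 : polyIntegral (P * R) = -(N * polyIntegral (P * P)) := by
    have h0 : polyIntegral (P * (R + C (N : ℝ) * P)) = 0 := by
      refine polyIntegral_legendrePoly_mul_eq_zero
        (natDegree_lt_of_coeff_eq_zero (by lia) ?_ ?_)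
      · exact natDegree_add_le_of_degree_le hRd.le ((natDegree_C_mul_le _ _).trans hPd.le)
      · rw [coeff_add, coeff_C_mul, hRc]; ring
    rw [mul_add, map_add, mul_left_comm, polyIntegral_C_mul] at h0
    linarith
  have h2 : polyIntegral (lobattoPoly N * s) = (N + 1) * polyIntegral (P * P) := by
    have h0 : polyIntegral (lobattoPoly N * (s - C (1 / (N : ℝ)) * derivative P)) = 0 := by
      refine polyIntegral_lobattoPoly_mul_eq_zero
        (natDegree_lt_of_coeff_eq_zero (by lia) ?_ ?_)
      · exact (natDegree_sub_le_of_le hsd.le ((natDegree_C_mul_le _ _).trans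
          (natDegree_derivative_legendrePoly_le N))).trans_eq (max_self _)
      · rw [coeff_sub, coeff_C_mul, hsc', coeff_derivative_legendrePoly (by lia)]
        field_simp
        simp [hP]
    rw [mul_sub, map_sub, mul_left_comm, polyIntegral_C_mul,
      polyIntegral_lobattoPoly_mul_derivative] at h0
    field_simp at h0
    linarith
  have h3 : P * R = C (P.eval a) * R + lobattoPoly N * s := by
    linear_combination R * hs + s * h
  rw [h3, map_add, polyIntegral_C_mul, h2] at h1
  linarith

lemma eval_cofactor {N : ℕ} {R : ℝ[X]} {a : ℝ} (h : (X - C a) * R = lobattoPoly N) :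
    R.eval a = -((N : ℝ) * (N + 1)) * (legendrePoly N).eval a := by
  have h1 := derivative_one_sub_X_sq_mul_derivative_legendrePoly N
  rw [← lobattoPoly, ← h] at h1
  have h2 := congrArg (eval a) h1
  simpa using h2

section Quadrature

variable {N : ℕ} {x : Fin (N + 1) → ℝ}

lemma exists_cofactor (hroot : ∀ i, (lobattoPoly N).eval (x i) = 0) (i : Fin (N + 1)) :
    ∃ R, (X - C (x i)) * R = lobattoPoly N := by
  obtain ⟨R, hR⟩ := dvd_iff_isRoot.2 (hroot i)
  exact ⟨R, hR.symm⟩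

lemma eval_cofactor_of_ne (hx : Function.Injective x)
    (hroot : ∀ i, (lobattoPoly N).eval (x i) = 0) {R : ℝ[X]} {i j : Fin (N + 1)}
    (h : (X - C (x i)) * R = lobattoPoly N) (hij : j ≠ i) : R.eval (x j) = 0 := by
  have h1 := hroot j
  rw [← h, eval_mul] at h1
  refine (mul_eq_zero.1 h1).resolve_left ?_
  simpa [sub_eq_zero] using hx.ne hij

lemma eval_legendrePoly_node_ne_zero (hN : 1 ≤ N) (hx : Function.Injective x)
    (hroot : ∀ i, (lobattoPoly N).eval (x i) = 0) (i : Fin (N + 1)) :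
    (legendrePoly N).eval (x i) ≠ 0 := by
  intro h0
  obtain ⟨R, hR⟩ := exists_cofactor hroot i
  obtain ⟨hRd, hRc⟩ := natDegree_and_coeff_of_X_sub_C_mul hR (natDegree_lobattoPoly hN)
  have hR0 : R = 0 := by
    refine eq_zero_of_natDegree_lt_card_of_eval_eq_zero R hx (fun j => ?_) (by simp [hRd])
    rcases eq_or_ne j i with rfl | hji
    · rw [eval_cofactor hR, h0, mul_zero]
    · exact eval_cofactor_of_ne hx hroot hR hji
  rw [hR0, coeff_zero] at hRc
  exact coeff_lobattoPoly_ne_zero hN hRc.symm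

lemma eq_sum_eval_smul_basis (hx : Function.Injective x) {u : ℝ[X]} (hu : u.natDegree ≤ N) :
    u = ∑ i, u.eval (x i) • Lagrange.basis univ x i := by
  have h := Lagrange.eq_interpolate (s := univ) (f := u) hx.injOn (by
    rw [card_univ, Fintype.card_fin]
    exact (degree_le_of_natDegree_le hu).trans_lt (by exact_mod_cast N.lt_succ_self))
  rw [Lagrange.interpolate_apply] at h
  simpa only [smul_eq_C_mul] using h

lemma polyIntegral_basis (hN : 2 ≤ N) (hx : Function.Injective x)
    (hroot : ∀ i, (lobattoPoly N).eval (x i) = 0) (i : Fin (N + 1)) :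
    polyIntegral (Lagrange.basis univ x i) =
      (2 * N + 1) * polyIntegral (legendrePoly N * legendrePoly N) / 2 *
        (2 / ((N : ℝ) * (N + 1) * (legendrePoly N).eval (x i) ^ 2)) := by
  obtain ⟨R, hR⟩ := exists_cofactor hroot i
  have hRd := (natDegree_and_coeff_of_X_sub_C_mul hR (natDegree_lobattoPoly (by lia))).1
  have hP := eval_legendrePoly_node_ne_zero (by lia) hx hroot i
  have h1 := eval_mul_polyIntegral_cofactor hN hR
  have h2 := eq_sum_eval_smul_basis hx hRd.le
  rw [sum_eq_single i (fun j _ hji => by rw [eval_cofactor_of_ne hx hroot hR hji, zero_smul])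
    (by simp), eval_cofactor hR] at h2
  rw [h2, map_smul, smul_eq_mul] at h1
  have hN0 : (N : ℝ) ≠ 0 := by positivity
  field_simp
  linarith

/-- Exactness of Legendre–Gauss–Lobatto quadrature, up to normalisation, on polynomials of degree
at most `2N - 1`. -/
lemma polyIntegral_eq_sum (hN : 2 ≤ N) (hx : Function.Injective x)
    (hroot : ∀ i, (lobattoPoly N).eval (x i) = 0) {g : ℝ[X]} (hg : g.natDegree ≤ 2 * N - 1) :
    polyIntegral g = (2 * N + 1) * polyIntegral (legendrePoly N * legendrePoly N) / 2 *
      ∑ i, g.eval (x i) * (2 / ((N : ℝ) * (N + 1) * (legendrePoly N).eval (x i) ^ 2)) := by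
  have hQd := natDegree_lobattoPoly (N := N) (by lia)
  have hdm := EuclideanDomain.div_add_mod g (lobattoPoly N)
  have hrd : (g % lobattoPoly N).natDegree ≤ N := by
    have := natDegree_mod_lt g (q := lobattoPoly N) (by lia)
    lia
  have hmul : (lobattoPoly N * (g / lobattoPoly N)).natDegree ≤ 2 * N - 1 := by
    rw [eq_sub_of_add_eq hdm]
    exact (natDegree_sub_le_of_le hg (hrd.trans (by lia : N ≤ 2 * N - 1))).trans_eq (max_self _)
  have hqd : (g / lobattoPoly N).natDegree < N - 1 := by
    by_cases h0 : g / lobattoPoly N = 0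
    · rw [h0, natDegree_zero]; lia
    · have hQ0 : lobattoPoly N ≠ 0 := by
        intro h
        rw [h, natDegree_zero] at hQd
        lia
      rw [natDegree_mul hQ0 h0, hQd] at hmul
      lia
  have heval : ∀ i, (g % lobattoPoly N).eval (x i) = g.eval (x i) := by
    intro i
    conv_rhs => rw [← hdm]
    rw [eval_add, eval_mul, hroot i, zero_mul, zero_add]
  conv_lhs => rw [← hdm, map_add, polyIntegral_lobattoPoly_mul_eq_zero hqd, zero_add,
    eq_sum_eval_smul_basis hx hrd, map_sum]
  rw [mul_sum]
  refine sum_congr rfl fun i _ => ?_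
  rw [map_smul, polyIntegral_basis hN hx hroot, heval, smul_eq_mul]
  ring

/-- The discrete advection term vanishes for polynomials with homogeneous boundary values. -/
lemma sum_derivative_mul_self_eq_zero (hN : 2 ≤ N) (hx : Function.Injective x)
    (hroot : ∀ i, (lobattoPoly N).eval (x i) = 0) {u : ℝ[X]} (hu : u.natDegree ≤ N)
    (hu₁ : u.eval (-1) = 0) (hu₂ : u.eval 1 = 0) :
    ∑ i, (derivative u).eval (x i) * u.eval (x i) *
      (2 / ((N : ℝ) * (N + 1) * (legendrePoly N).eval (x i) ^ 2)) = 0 := by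
  have hd : (derivative u * u).natDegree ≤ 2 * N - 1 := by
    have h1 := natDegree_derivative_le u
    have h2 := natDegree_mul_le (p := derivative u) (q := u)
    lia
  have h := polyIntegral_eq_sum hN hx hroot hd
  have h0 : polyIntegral (derivative u * u) = 0 := by
    have h3 := polyIntegral_derivative (u * u)
    rw [derivative_mul, mul_comm u, map_add] at h3
    simp [hu₁, hu₂] at h3
    linarith
  have hP0 : legendrePoly N ≠ 0 := by
    intro h
    have := coeff_legendrePoly_ne_zero (N := N) (by lia)
    simp [h] at this
  have hpos := polyIntegral_sq_pos hP0
  rw [h0] at h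
  simpa only [eval_mul] using (mul_eq_zero.1 h.symm).resolve_left (by positivity)

end Quadrature

lemma exists_quadraticForm_le {ι : Type*} [Fintype ι] (a : ι → ι → ℝ) {w : ι → ℝ}
    (hw : ∀ i, 0 < w i) :
    ∃ K, 0 ≤ K ∧ ∀ c : ι → ℝ, ∑ j, ∑ i, a j i * (c i * c j) ≤ K * ∑ i, c i ^ 2 * w i := by
  have hterm : ∀ j i, 0 ≤ |a j i| * ((1 / w i + 1 / w j) / 2) := fun j i => by
    have := hw i
    have := hw j
    positivity
  refine ⟨∑ j, ∑ i, |a j i| * ((1 / w i + 1 / w j) / 2),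
    sum_nonneg fun j _ => sum_nonneg fun i _ => hterm j i, fun c => ?_⟩
  have hsq : ∀ i, c i ^ 2 ≤ 1 / w i * ∑ k, c k ^ 2 * w k := by
    intro i
    have h := single_le_sum (f := fun k => c k ^ 2 * w k)
      (fun k _ => mul_nonneg (sq_nonneg (c k)) (hw k).le) (mem_univ i)
    rw [one_div_mul_eq_div, le_div_iff₀ (hw i)]
    exact h
  rw [sum_mul]
  refine sum_le_sum fun j _ => ?_
  rw [sum_mul]
  refine sum_le_sum fun i _ => ?_
  have h1 : |c i * c j| ≤ (c i ^ 2 + c j ^ 2) / 2 := by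
    rw [abs_mul, ← sq_abs (c i), ← sq_abs (c j)]
    linarith [two_mul_le_add_sq |c i| |c j|]
  calc a j i * (c i * c j) ≤ |a j i| * |c i * c j| := by
        rw [← abs_mul]; exact le_abs_self _
    _ ≤ |a j i| * ((1 / w i + 1 / w j) / 2 * ∑ k, c k ^ 2 * w k) := by
        refine mul_le_mul_of_nonneg_left ?_ (abs_nonneg _)
        linarith [hsq i, hsq j]
    _ = _ := by ring

/-- A differential Grönwall inequality with an integrated source term. -/
lemma le_exp_mul_add_integral {E E' F : ℝ → ℝ} {C T : ℝ} (hC : 0 ≤ C) (hT : 0 ≤ T)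
    (hE : ∀ t, HasDerivAt E (E' t) t) (hF : Continuous F) (hF0 : ∀ t, 0 ≤ F t)
    (h : ∀ t, 0 < t → E' t ≤ C * E t + F t) :
    E T ≤ Real.exp (C * T) * (E 0 + ∫ t in (0 : ℝ)..T, F t) := by
  set g : ℝ → ℝ := fun t => Real.exp (-(C * t)) * E t - ∫ s in (0 : ℝ)..t, F s with hg
  have hgd : ∀ t, HasDerivAt g
      (Real.exp (-(C * t)) * (-C) * E t + Real.exp (-(C * t)) * E' t - F t) t := by
    intro t
    have h1 : HasDerivAt (fun t => -(C * t)) (-C) t := by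
      simpa using ((hasDerivAt_id t).const_mul C).fun_neg
    exact (h1.exp.mul (hE t)).sub (hF.integral_hasStrictDerivAt 0 t).hasDerivAt
  have hanti : AntitoneOn g (Set.Icc 0 T) := by
    refine antitoneOn_of_deriv_nonpos (convex_Icc 0 T)
      (fun t _ => (hgd t).continuousAt.continuousWithinAt)
      (fun t _ => (hgd t).differentiableAt.differentiableWithinAt) fun t ht => ?_
    rw [interior_Icc] at ht
    rw [(hgd t).deriv]
    have he : 0 < Real.exp (-(C * t)) := Real.exp_pos _
    have he1 : Real.exp (-(C * t)) ≤ 1 :=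
      Real.exp_le_one_iff.2 (neg_nonpos.2 (mul_nonneg hC ht.1.le))
    have h2 := mul_le_mul_of_nonneg_left (h t ht.1) he.le
    have h3 := mul_le_mul_of_nonneg_right he1 (hF0 t)
    linarith
  have hfin := hanti (Set.left_mem_Icc.2 hT) (Set.right_mem_Icc.2 hT) hT
  simp only [hg, mul_zero, neg_zero, Real.exp_zero, one_mul, intervalIntegral.integral_same,
    sub_zero] at hfin
  have h4 : Real.exp (-(C * T)) * E T ≤ E 0 + ∫ s in (0 : ℝ)..T, F s := by linarith
  have h5 := mul_le_mul_of_nonneg_left h4 (Real.exp_pos (C * T)).le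
  rwa [← mul_assoc, ← Real.exp_add, add_neg_cancel, Real.exp_zero, one_mul] at h5

/-- The discrete diffusion term is bounded by the discrete norm. -/
lemma exists_fracGrad_form_le {N : ℕ} {α : ℝ} (hα : α < 2) (κ p q : ℝ)
    {x : Fin (N + 1) → ℝ} (hx : StrictMono x) (hx0 : x 0 = -1) (hxN : x (Fin.last N) = 1)
    {w : Fin (N + 1) → ℝ} (hw : ∀ i, 0 < w i) :
    ∃ K, 0 ≤ K ∧ ∀ u : ℝ[X], u.natDegree ≤ N → u.eval (-1) = 0 → u.eval 1 = 0 →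
      κ * ∑ j, fracGrad α p q (fun s => u.eval s) (x j) * u.eval (x j) * w j ≤
        K * ∑ j, u.eval (x j) ^ 2 * w j := by
  have hL : ∀ j, ∃ L : ℝ[X] →ₗ[ℝ] ℝ, ∀ u : ℝ[X], u.eval (-1) = 0 → u.eval 1 = 0 →
      fracGrad α p q (fun s => u.eval s) (x j) * u.eval (x j) = L u * u.eval (x j) := by
    intro j
    by_cases h1 : x j = -1
    · exact ⟨0, fun u hu _ => by rw [h1, hu, mul_zero, mul_zero]⟩
    by_cases h2 : x j = 1
    · exact ⟨0, fun u _ hu => by rw [h2, hu, mul_zero, mul_zero]⟩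
    have h3 : -1 < x j := lt_of_le_of_ne (hx0 ▸ hx.monotone (Fin.zero_le j)) (Ne.symm h1)
    have h4 : x j < 1 := lt_of_le_of_ne (hxN ▸ hx.monotone (Fin.le_last j)) h2
    obtain ⟨L, hL⟩ := exists_linearMap_eq_fracGrad hα p q h3 h4
    exact ⟨L, fun u _ _ => by rw [hL]⟩
  choose L hL using hL
  obtain ⟨K, hK0, hK⟩ := exists_quadraticForm_le
    (fun j i => κ * L j (Lagrange.basis univ x i) * w j) hw
  refine ⟨K, hK0, fun u hu hu₁ hu₂ => ?_⟩
  refine le_of_eq_of_le ?_ (hK fun i => u.eval (x i))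
  rw [mul_sum]
  refine sum_congr rfl fun j _ => ?_
  rw [hL j u hu₁ hu₂]
  conv_lhs => rw [eq_sum_eval_smul_basis hx.injective hu, map_sum,
    ← eq_sum_eval_smul_basis hx.injective hu]
  rw [sum_mul, sum_mul, mul_sum]
  refine sum_congr rfl fun i _ => ?_
  rw [map_smul, smul_eq_mul]
  ring

/-- **Stability of the semi-discrete Legendre spectral collocation scheme**
(Theorem 1 of the paper).  On the Legendre–Gauss–Lobatto nodes
`-1 = x_0 < … < x_N = 1` with weights `w_i = 2/(N(N+1)P_N(x_i)²)`, there is a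
constant `C = C(N,α,κ_α,p,q) > 0` such that any solution `u_N` (a time-dependent
polynomial of degree ≤ N vanishing at `±1`, with nodal values `U'` for its time
derivative) of the semi-discrete scheme
`(∂_t u_N, v)_N = κ_α(∇^α u_N, v)_N − ν_α(∂_x u_N, v)_N + (f, v)_N`
for all test polynomials `v` of degree ≤ N vanishing at `±1`, satisfies
`‖u_N(·,T)‖_N² ≤ exp(CT)(‖u_N(·,0)‖_N² + ∫_0^T ‖f(·,t)‖_N² dt)`. -/
theorem semi_discrete_scheme_stability (N : ℕ) (hN : 2 ≤ N)
    (α : ℝ) (hα₁ : 1 < α) (hα₂ : α < 2) (κ : ℝ) (hκ : 0 < κ)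
    (p q : ℝ) (hp : 0 ≤ p) (hq : 0 ≤ q) (hpq : p + q = 1)
    (x : Fin (N + 1) → ℝ) (hx : StrictMono x)
    (hx0 : x 0 = -1) (hxN : x (Fin.last N) = 1)
    (hroot : ∀ i, (1 - x i ^ 2) * deriv (legendreP N) (x i) = 0)
    (w : Fin (N + 1) → ℝ)
    (hw : ∀ i, w i = 2 / ((N : ℝ) * (N + 1) * legendreP N (x i) ^ 2)) :
    ∃ C > 0, ∀ ν : ℝ, 0 < ν →
      ∀ (U : ℝ → Polynomial ℝ) (U' : ℝ → Fin (N + 1) → ℝ) (f : ℝ → Fin (N + 1) → ℝ),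
      (∀ t, (U t).natDegree ≤ N) →
      (∀ t, (U t).eval (-1) = 0) → (∀ t, (U t).eval 1 = 0) →
      (∀ j, ∀ t, HasDerivAt (fun s => (U s).eval (x j)) (U' t j) t) →
      (∀ j, Continuous fun t => U' t j) →
      (∀ j, Continuous fun t => f t j) →
      (∀ t, 0 < t → ∀ v : Polynomial ℝ, v.natDegree ≤ N →
        v.eval (-1) = 0 → v.eval 1 = 0 →
        ∑ j : Fin (N + 1), U' t j * v.eval (x j) * w j =
          κ * ∑ j : Fin (N + 1),
              fracGrad α p q (fun s => (U t).eval s) (x j) * v.eval (x j) * w j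
            - ν * ∑ j : Fin (N + 1), (U t).derivative.eval (x j) * v.eval (x j) * w j
            + ∑ j : Fin (N + 1), f t j * v.eval (x j) * w j) →
      ∀ T : ℝ, 0 < T →
        ∑ j : Fin (N + 1), ((U T).eval (x j)) ^ 2 * w j ≤
          Real.exp (C * T) *
            (∑ j : Fin (N + 1), ((U 0).eval (x j)) ^ 2 * w j +
              ∫ t in (0 : ℝ)..T, ∑ j : Fin (N + 1), (f t j) ^ 2 * w j) := by
  have hdP : ∀ y, deriv (legendreP N) y = (derivative (legendrePoly N)).eval y := by
    intro y
    rw [legendreP_eq_eval_s18]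
    exact Polynomial.deriv _
  have hroot' : ∀ i, (lobattoPoly N).eval (x i) = 0 := by
    intro i
    rw [← hroot i, hdP, lobattoPoly]
    simp
  have hw' : ∀ i, w i = 2 / ((N : ℝ) * (N + 1) * (legendrePoly N).eval (x i) ^ 2) := by
    intro i
    rw [hw, legendreP_eq_eval_s18]
  have hwpos : ∀ i, 0 < w i := by
    intro i
    rw [hw']
    have := eval_legendrePoly_node_ne_zero (by lia) hx.injective hroot' i
    have : (0 : ℝ) < N := by exact_mod_cast (by lia : 0 < N)
    positivity
  obtain ⟨K, hK0, hK⟩ := exists_fracGrad_form_le hα₂ κ p q hx hx0 hxN hwpos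
  refine ⟨2 * K + 1, by linarith, ?_⟩
  intro ν _ U U' f hdeg hm1 h1 hU' _ hf hscheme T hT
  refine le_exp_mul_add_integral (E := fun t => ∑ j, (U t).eval (x j) ^ 2 * w j)
    (E' := fun t => ∑ j, 2 * (U t).eval (x j) * U' t j * w j)
    (F := fun t => ∑ j, f t j ^ 2 * w j) (by linarith) hT.le ?_ ?_ ?_ ?_
  · intro t
    refine HasDerivAt.fun_sum fun j _ => ?_
    simpa using ((hU' j t).pow 2).mul_const (w j)
  · exact continuous_finsetSum _ fun j _ => ((hf j).pow 2).mul continuous_const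
  · exact fun t => sum_nonneg fun j _ => mul_nonneg (sq_nonneg _) (hwpos j).le
  · intro t ht
    have hs := hscheme t ht (U t) (hdeg t) (hm1 t) (h1 t)
    have hadv := sum_derivative_mul_self_eq_zero hN hx.injective hroot' (hdeg t) (hm1 t) (h1 t)
    simp only [← hw'] at hadv
    rw [hadv, mul_zero, sub_zero] at hs
    have hdiff := hK (U t) (hdeg t) (hm1 t) (h1 t)
    have hsrc : 2 * ∑ j, f t j * (U t).eval (x j) * w j ≤
        ∑ j, f t j ^ 2 * w j + ∑ j, (U t).eval (x j) ^ 2 * w j := by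
      rw [mul_sum, ← sum_add_distrib]
      refine sum_le_sum fun j _ => ?_
      rw [← add_mul, ← mul_assoc, ← mul_assoc]
      exact mul_le_mul_of_nonneg_right (two_mul_le_add_sq _ _) (hwpos j).le
    have hE' : ∑ j, 2 * (U t).eval (x j) * U' t j * w j =
        2 * ∑ j, U' t j * (U t).eval (x j) * w j := by
      rw [mul_sum]
      exact sum_congr rfl fun j _ => by ring
    rw [hE', hs]
    linarith
end
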